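/- Let q ≥ 1, b = q + 1, and let M₁, M₂, m, α, ρ, m(t), Ψ(t), Ψ(P) be as in the construction. Let κ ≥ 1 and let n₁, …, n_κ be natural numbers (repetitions allowed), each belonging to Ψ(P), let I ⊆ Fin m, and suppose n₁ + ⋯ + n_κ = q·b^α + Σ_{p ∈ I} q·b^(3q+p) + Σ_{j=0}^{3q−1} q·b^j. Then κ = q and there exist pairwise distinct triples t₁, …, t_κ ∈ M₁ ∪ M₂ such that n_k ∈ Ψ(t_k) for every k ∈ {1, …, κ} and the set {t₁, …, t_κ} is a perfect matching. -/

import Mathlib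

/-- The base-`b` digit of `n` at position `j`. -/
def digit (b j n : ℕ) : ℕ := n / b ^ j % b

/-- A subset `ν` of `Fin q × Fin q × Fin q` (as a finset) is a perfect matching if
it has exactly `q` elements and no two distinct elements agree in any coordinate. -/
def IsPerfectMatching (q : ℕ) (ν : Finset (Fin q × Fin q × Fin q)) : Prop :=
  ν.card = q ∧ ∀ t ∈ ν, ∀ t' ∈ ν, t ≠ t' →
    t.1 ≠ t'.1 ∧ t.2.1 ≠ t'.2.1 ∧ t.2.2 ≠ t'.2.2

/-- The match-set `m(t)` of a triple `t = (j₁, j₂, j₃)`: all numbers of the form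
`d₁·b^(2q+j₁) + d₂·b^(q+j₂) + d₃·b^(j₃)` with `d₁, d₂, d₃ ∈ [0, q]`, where `b = q+1`. -/
def matchSet (q : ℕ) (t : Fin q × Fin q × Fin q) : Set ℕ :=
  {n | ∃ d₁ d₂ d₃ : ℕ, d₁ ≤ q ∧ d₂ ≤ q ∧ d₃ ≤ q ∧
    n = d₁ * (q + 1) ^ (2 * q + (t.1 : ℕ)) + d₂ * (q + 1) ^ (q + (t.2.1 : ℕ))
      + d₃ * (q + 1) ^ ((t.2.2 : ℕ))}

/-- The set `Ψ(t)` of constructed integers for a triple `t`, where `ρ` is the rank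
function on `M₁`, `α = 3q + |M₁|` and `b = q + 1`.
For `t ∈ M₁`: `Ψ(t) = { b^α + d₀·b^(3q+ρ(t)) + s : d₀ ∈ [1, q], s ∈ m(t) }`;
otherwise (for `t ∈ M₂`): `Ψ(t) = { b^α + s : s ∈ m(t) }`. -/
def Psi (q : ℕ) (M₁ : Finset (Fin q × Fin q × Fin q))
    (ρ : Fin q × Fin q × Fin q → ℕ) (t : Fin q × Fin q × Fin q) : Set ℕ :=
  if t ∈ M₁ then
    {n | ∃ d₀ s : ℕ, 1 ≤ d₀ ∧ d₀ ≤ q ∧ s ∈ matchSet q t ∧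
      n = (q + 1) ^ (3 * q + M₁.card) + d₀ * (q + 1) ^ (3 * q + ρ t) + s}
  else
    {n | ∃ s ∈ matchSet q t, n = (q + 1) ^ (3 * q + M₁.card) + s}

/-- `Ψ(P) = ⋃_{t ∈ M₁ ∪ M₂} Ψ(t)`. -/
def PsiP (q : ℕ) (M₁ M₂ : Finset (Fin q × Fin q × Fin q))
    (ρ : Fin q × Fin q × Fin q → ℕ) : Set ℕ :=
  ⋃ t ∈ (M₁ ∪ M₂ : Finset (Fin q × Fin q × Fin q)), Psi q M₁ ρ t

/-- If every summand has a vanishing digit at position `J` and there are at most `q` of them, the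
sum cannot have all of its digits up to position `J` equal to `q`. -/
theorem exists_pow_le_mod {q κ J : ℕ} (hq : 1 ≤ q) (hκ : κ ≤ q) (n : Fin κ → ℕ)
    (h : (q + 1) ^ (J + 1) ∣ ∑ i, n i + 1) :
    ∃ k, (q + 1) ^ J ≤ n k % (q + 1) ^ (J + 1) := by
  by_contra! hlt
  have hpos : 0 < (q + 1) ^ J := by positivity
  have hdvd : (q + 1) ^ (J + 1) ∣ ∑ i, n i % (q + 1) ^ (J + 1) + 1 := by
    rw [Nat.dvd_iff_mod_eq_zero, Nat.add_mod, Finset.sum_nat_mod] at h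
    rwa [Nat.dvd_iff_mod_eq_zero, Nat.add_mod]
  have hle : ∑ i, n i % (q + 1) ^ (J + 1) ≤ κ * ((q + 1) ^ J - 1) := by
    simpa using Finset.sum_le_card_nsmul Finset.univ (fun i => n i % (q + 1) ^ (J + 1))
      ((q + 1) ^ J - 1) fun i _ => Nat.le_sub_one_of_lt (hlt i)
  have hle' := hle.trans (Nat.mul_le_mul_right _ hκ)
  have hfin := Nat.le_of_dvd (Nat.succ_pos _) hdvd
  rw [pow_succ] at hfin hle'
  obtain ⟨c, hc⟩ := Nat.exists_eq_add_of_lt hpos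
  rw [hc] at hfin hle'
  simp only [zero_add, Nat.add_sub_cancel] at hfin hle'
  nlinarith

theorem mul_pow_add_lt {q d e r : ℕ} (hd : d ≤ q) (hr : r < (q + 1) ^ e) :
    d * (q + 1) ^ e + r < (q + 1) ^ (e + 1) := by
  rw [pow_succ]
  nlinarith [Nat.mul_le_mul_right ((q + 1) ^ e) hd]

/-- A number whose only possibly nonzero base-`(q + 1)` digit in positions `[L, B)` is at `e` has a
nonzero digit at position `J ∈ [L, B)` only if `e = J`. -/
theorem eq_of_pow_le_mod {q H d r L e B J : ℕ} (hd : d ≤ q) (hr : r < (q + 1) ^ L)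
    (hLe : L ≤ e) (hLJ : L ≤ J) (hJB : J < B)
    (h : (q + 1) ^ J ≤ (H * (q + 1) ^ B + (d * (q + 1) ^ e + r)) % (q + 1) ^ (J + 1)) :
    e = J := by
  have mono : ∀ {x y : ℕ}, x ≤ y → (q + 1) ^ x ≤ (q + 1) ^ y :=
    fun hxy => Nat.pow_le_pow_right (Nat.succ_pos q) hxy
  have key : ∀ x y, (q + 1) ^ (J + 1) ∣ x → y < (q + 1) ^ J →
      (x + y) % (q + 1) ^ (J + 1) < (q + 1) ^ J := by
    rintro _ y ⟨c, rfl⟩ hy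
    rw [Nat.mul_add_mod]
    exact (Nat.mod_le _ _).trans_lt hy
  have hB : (q + 1) ^ (J + 1) ∣ H * (q + 1) ^ B := (pow_dvd_pow _ hJB).mul_left _
  rcases lt_trichotomy e J with hlt | heq | hgt
  · exact absurd h (not_le.2 (key _ _ hB
      ((mul_pow_add_lt hd (hr.trans_le (mono hLe))).trans_le (mono hlt))))
  · exact heq
  · rw [← add_assoc] at h
    exact absurd h (not_le.2 (key _ _ (hB.add ((pow_dvd_pow _ hgt).mul_left _))
      (hr.trans_le (mono hLJ))))

/-- Elements of `Ψ(t)` as a high part of size at least `b ^ |M₁|` above three digits. -/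
theorem exists_eq_of_mem_Psi {q : ℕ} {M₁ : Finset (Fin q × Fin q × Fin q)}
    {ρ : Fin q × Fin q × Fin q → ℕ} {t : Fin q × Fin q × Fin q} {n : ℕ}
    (h : n ∈ Psi q M₁ ρ t) :
    ∃ H d₁ d₂ d₃ : ℕ, (q + 1) ^ M₁.card ≤ H ∧ d₁ ≤ q ∧ d₂ ≤ q ∧ d₃ ≤ q ∧
      n = H * (q + 1) ^ (3 * q) + (d₁ * (q + 1) ^ (2 * q + (t.1 : ℕ))
        + (d₂ * (q + 1) ^ (q + (t.2.1 : ℕ)) + d₃ * (q + 1) ^ (t.2.2 : ℕ))) := by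
  unfold Psi at h
  split_ifs at h
  · obtain ⟨d₀, s, -, -, ⟨d₁, d₂, d₃, h₁, h₂, h₃, rfl⟩, rfl⟩ := h
    exact ⟨(q + 1) ^ M₁.card + d₀ * (q + 1) ^ ρ t, d₁, d₂, d₃, Nat.le_add_right _ _, h₁, h₂, h₃,
      by ring⟩
  · obtain ⟨s, ⟨d₁, d₂, d₃, h₁, h₂, h₃, rfl⟩, rfl⟩ := h
    exact ⟨(q + 1) ^ M₁.card, d₁, d₂, d₃, le_rfl, h₁, h₂, h₃, by ring⟩

theorem sum_range_mul_pow_add_one (q N : ℕ) :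
    ∑ j ∈ Finset.range N, q * (q + 1) ^ j + 1 = (q + 1) ^ N := by
  induction N with
  | zero => simp
  | succ N ih => rw [Finset.sum_range_succ, pow_succ, ← ih]; ring

/-- statement (II) of the paper: in any decomposition of the target as
a sum of `κ` elements of `Ψ(P)`, we have `κ = q` and there are pairwise distinct
triples `t₁, …, t_κ ∈ M₁ ∪ M₂` with `n_k ∈ Ψ(t_k)` forming a perfect matching. -/
theorem stmt_10 (q : ℕ) (hq : 1 ≤ q)
    (M₁ M₂ : Finset (Fin q × Fin q × Fin q)) (hdisj : Disjoint M₁ M₂)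
    (ρ : Fin q × Fin q × Fin q → ℕ)
    (hρ : Set.BijOn ρ ↑M₁ (Set.Iio M₁.card))
    (κ : ℕ) (hκ : 1 ≤ κ) (n : Fin κ → ℕ)
    (hn : ∀ i : Fin κ, n i ∈ PsiP q M₁ M₂ ρ)
    (I : Finset ℕ) (hI : ∀ p ∈ I, p < M₁.card)
    (hsum : ∑ i, n i =
      q * (q + 1) ^ (3 * q + M₁.card)
        + ∑ p ∈ I, q * (q + 1) ^ (3 * q + p)
        + ∑ j ∈ Finset.range (3 * q), q * (q + 1) ^ j) :
    κ = q ∧ ∃ t : Fin κ → Fin q × Fin q × Fin q,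
      Function.Injective t ∧
      (∀ k : Fin κ, t k ∈ M₁ ∪ M₂) ∧
      (∀ k : Fin κ, n k ∈ Psi q M₁ ρ (t k)) ∧
      IsPerfectMatching q (Finset.image t Finset.univ) := by
  choose t htM htΨ using fun i => by simpa only [PsiP, Set.mem_iUnion, exists_prop] using hn i
  choose H d₁ d₂ d₃ hH hd₁ hd₂ hd₃ hnk using fun i => exists_eq_of_mem_Psi (htΨ i)
  have hdvd : (q + 1) ^ (3 * q) ∣ ∑ i, n i + 1 := by
    rw [hsum, add_assoc, sum_range_mul_pow_add_one]
    refine Dvd.dvd.add (Dvd.dvd.add ?_ (Finset.dvd_sum fun p _ => ?_)) dvd_rfl <;>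
      exact (pow_dvd_pow _ (Nat.le_add_right _ _)).mul_left _
  have hupper : ∑ i, n i + 1 ≤ (q + 1) * (q + 1) ^ (3 * q + M₁.card) := by
    have hI' : ∑ p ∈ I, q * (q + 1) ^ (3 * q + p) ≤
        ∑ p ∈ Finset.range M₁.card, q * (q + 1) ^ (3 * q + p) :=
      Finset.sum_le_sum_of_subset fun p hp => Finset.mem_range.2 (hI p hp)
    have hall := sum_range_mul_pow_add_one q (3 * q + M₁.card)
    rw [Finset.sum_range_add] at hall
    rw [hsum, add_mul, ← hall]
    omega
  have hlower : κ * (q + 1) ^ (3 * q + M₁.card) ≤ ∑ i, n i := by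
    simpa using Finset.card_nsmul_le_sum Finset.univ n ((q + 1) ^ (3 * q + M₁.card)) fun i _ => by
      rw [hnk i, add_comm (3 * q), pow_add]
      exact (Nat.mul_le_mul_right _ (hH i)).trans (Nat.le_add_right _ _)
  have hκq : κ ≤ q :=
    Nat.lt_succ_iff.1 (lt_of_mul_lt_mul_right (Nat.lt_of_succ_le
      ((Nat.succ_le_succ hlower).trans hupper)) (Nat.zero_le _))
  have hdigit : ∀ J < 3 * q, ∃ k, (q + 1) ^ J ≤ n k % (q + 1) ^ (J + 1) := fun J hJ =>
    exists_pow_le_mod hq hκq n ((pow_dvd_pow _ hJ).trans hdvd)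
  have hmono : ∀ {x y : ℕ}, x ≤ y → (q + 1) ^ x ≤ (q + 1) ^ y :=
    fun hxy => Nat.pow_le_pow_right (Nat.succ_pos q) hxy
  have hlow₃ : ∀ k, d₃ k * (q + 1) ^ ((t k).2.2 : ℕ) < (q + 1) ^ q := fun k =>
    (mul_pow_add_lt (r := 0) (hd₃ k) (by positivity)).trans_le (hmono (t k).2.2.isLt)
  have hlow₂ : ∀ k, d₂ k * (q + 1) ^ (q + ((t k).2.1 : ℕ)) + d₃ k * (q + 1) ^ ((t k).2.2 : ℕ)
      < (q + 1) ^ (2 * q) := fun k =>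
    (mul_pow_add_lt (hd₂ k) ((hlow₃ k).trans_le (hmono (Nat.le_add_right _ _)))).trans_le
      (hmono (by have := (t k).2.1.isLt; omega))
  have hsurj₁ : Function.Surjective fun k => (t k).1 := fun j => by
    obtain ⟨k, hk⟩ := hdigit (2 * q + j) (by omega)
    rw [hnk k] at hk
    have := eq_of_pow_le_mod (hd₁ k) (hlow₂ k) (by omega) (by omega) (by omega) hk
    exact ⟨k, Fin.ext (by simpa using this)⟩
  have hsurj₂ : Function.Surjective fun k => (t k).2.1 := fun j => by
    obtain ⟨k, hk⟩ := hdigit (q + j) (by omega)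
    rw [hnk k, ← add_assoc, show H k * (q + 1) ^ (3 * q) + d₁ k * (q + 1) ^ (2 * q + ((t k).1 : ℕ))
      = (H k * (q + 1) ^ q + d₁ k * (q + 1) ^ ((t k).1 : ℕ)) * (q + 1) ^ (2 * q) by ring] at hk
    have := eq_of_pow_le_mod (hd₂ k) (hlow₃ k) (by omega) (by omega) (by omega) hk
    exact ⟨k, Fin.ext (by simpa using this)⟩
  have hsurj₃ : Function.Surjective fun k => (t k).2.2 := fun j => by
    obtain ⟨k, hk⟩ := hdigit j (by omega)
    rw [hnk k, ← add_assoc, ← add_assoc, show H k * (q + 1) ^ (3 * q)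
      + d₁ k * (q + 1) ^ (2 * q + ((t k).1 : ℕ)) + d₂ k * (q + 1) ^ (q + ((t k).2.1 : ℕ))
      = (H k * (q + 1) ^ (2 * q) + d₁ k * (q + 1) ^ (q + ((t k).1 : ℕ))
        + d₂ k * (q + 1) ^ ((t k).2.1 : ℕ)) * (q + 1) ^ q by ring] at hk
    have := eq_of_pow_le_mod (L := 0) (r := 0) (hd₃ k) (by simp) (by omega) (by omega) j.isLt hk
    exact ⟨k, Fin.ext this⟩
  obtain rfl : κ = q := hκq.antisymm (by simpa using Fintype.card_le_of_surjective _ hsurj₁)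
  have hinj₁ := Finite.injective_iff_surjective.2 hsurj₁
  have hinj₂ := Finite.injective_iff_surjective.2 hsurj₂
  have hinj₃ := Finite.injective_iff_surjective.2 hsurj₃
  have hinj : Function.Injective t := fun k l hkl => hinj₁ (congrArg Prod.fst hkl)
  refine ⟨rfl, t, hinj, htM, htΨ, by simp [Finset.card_image_of_injective _ hinj], ?_⟩
  simp only [Finset.mem_image, Finset.mem_univ, true_and]
  rintro _ ⟨k, rfl⟩ _ ⟨l, rfl⟩ hne
  exact ⟨fun h => hne (congrArg t (hinj₁ h)), fun h => hne (congrArg t (hinj₂ h)),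
    fun h => hne (congrArg t (hinj₃ h))⟩
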